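/- arXiv:2510.11466 — 2 statements merged into one kernel-verified Lean document; each statement's English description precedes it below -/
import Mathlib

section
/- Let k be a field, X₁ a separated scheme of finite type over k, X₀ ⊆ X₁ a closed subscheme such that the open complement X₁ ∖ X₀ is affine. Let Z₁ ⊆ X₁ be an irreducible component with Z₁ ⊄ X₀ and Z₁ ∩ X₀ ≠ ∅, and let Z₀ be an irreducible component of Z₁ ∩ X₀. Then dim Z₁ = dim Z₀ + 1. -/
theorem ringKrullDim_eq_of_isIntegral {R S : Type*} [CommRing R] [CommRing S] [Algebra R S]
    [Algebra.IsIntegral R S] [FaithfulSMul R S] : ringKrullDim R = ringKrullDim S := by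
  apply le_antisymm
  · refine iSup_le fun l => ?_
    have hinj := FaithfulSMul.algebraMap_injective R S
    obtain ⟨P, hP, hPl⟩ := Ideal.exists_ideal_over_prime_of_isIntegral l.head.asIdeal (⊥ : Ideal S)
      (by rw [Ideal.comap_bot_of_injective _ hinj]; exact bot_le)
    have : P.LiesOver l.head.asIdeal := ⟨hPl.2.symm⟩
    have := hPl.1
    obtain ⟨L, hL, -⟩ := Ideal.exists_ltSeries_of_hasGoingUp l P
    rw [← hL]
    exact Order.LTSeries.length_le_krullDim L
  · exact Order.krullDim_le_of_strictMono (PrimeSpectrum.comap (algebraMap R S))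
      fun p q hpq => Ideal.IsIntegral.comap_lt_comap (I := p.asIdeal) (J := q.asIdeal) hpq

theorem exists_ringKrullDim_eq_trdeg_eq (k : Type*) {R : Type*} [Field k] [CommRing R]
    [IsDomain R] [Algebra k R] [Algebra.FiniteType k R] :
    ∃ n : ℕ, ringKrullDim R = n ∧ Algebra.trdeg k R = n := by
  obtain ⟨n, g, hg, hfin⟩ := exists_finite_inj_algHom_of_fg k R
  algebraize [g.toRingHom]
  have : Module.Finite (MvPolynomial (Fin n) k) R := hfin
  have : FaithfulSMul (MvPolynomial (Fin n) k) R :=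
    (faithfulSMul_iff_algebraMap_injective _ _).mpr hg
  have hsc : IsScalarTower k (MvPolynomial (Fin n) k) R :=
    IsScalarTower.of_algebraMap_eq' g.comp_algebraMap.symm
  refine ⟨n, ?_, ?_⟩
  · rw [← ringKrullDim_eq_of_isIntegral (R := MvPolynomial (Fin n) k),
      MvPolynomial.ringKrullDim_of_isNoetherianRing]
    simp
  · have := lift_trdeg_add_eq k (MvPolynomial (Fin n) k) R
    simp only [MvPolynomial.trdeg_of_isDomain, trdeg_eq_zero] at this
    simpa using this.symm

theorem ringKrullDim_eq_of_isAlgebraic (k : Type*) {R S : Type*} [Field k] [CommRing R]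
    [CommRing S] [IsDomain R] [IsDomain S] [Algebra k R] [Algebra k S] [Algebra R S]
    [IsScalarTower k R S] [FaithfulSMul R S] [Algebra.IsAlgebraic R S] [Algebra.FiniteType k R]
    [Algebra.FiniteType k S] : ringKrullDim R = ringKrullDim S := by
  obtain ⟨n, hn, hn'⟩ := exists_ringKrullDim_eq_trdeg_eq k (R := R)
  obtain ⟨m, hm, hm'⟩ := exists_ringKrullDim_eq_trdeg_eq k (R := S)
  have := lift_trdeg_add_eq k R S
  simp only [hn', hm', trdeg_eq_zero] at this
  have : n = m := by simpa using this
  rw [hn, hm, this]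

theorem ringKrullDim_quotient_succ_le_of_ne_bot {R : Type*} [CommRing R] [IsDomain R]
    {p : Ideal R} (hp : p ≠ ⊥) : ringKrullDim (R ⧸ p) + 1 ≤ ringKrullDim R := by
  obtain ⟨x, hx, hx0⟩ := Submodule.exists_mem_ne_zero_of_ne_bot hp
  exact ringKrullDim_succ_le_of_surjective (Ideal.Quotient.mk p) Ideal.Quotient.mk_surjective
    (mem_nonZeroDivisors_of_ne_zero hx0) (Ideal.Quotient.eq_zero_iff_mem.mpr hx)

theorem MvPolynomial.le_ringKrullDim_quotient_span_singleton {k : Type*} [Field k] {n : ℕ}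
    {f : MvPolynomial (Fin n) k} (hf : Prime f) :
    (n : WithBot ℕ∞) ≤ ringKrullDim (MvPolynomial (Fin n) k ⧸ Ideal.span {f}) + 1 := by
  obtain ⟨i, hi⟩ : ∃ i, f.degreeOf i ≠ 0 := by
    by_contra! h
    have h0 : f.totalDegree = 0 := by
      rw [totalDegree_eq_zero_iff]
      intro m hm i
      exact Nat.le_zero.mp ((h i) ▸ (degreeOf_le_iff.mp le_rfl m hm))
    rw [totalDegree_eq_zero_iff_eq_C] at h0
    apply hf.not_isUnit
    rw [h0]
    apply IsUnit.map
    rw [isUnit_iff_ne_zero]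
    rintro h1
    rw [h1, map_zero] at h0
    exact hf.ne_zero h0
  have hprime : (Ideal.span {f}).IsPrime := (Ideal.span_singleton_prime hf.ne_zero).mpr hf
  let x : {j // j ≠ i} → MvPolynomial (Fin n) k ⧸ Ideal.span {f} :=
    fun j => Ideal.Quotient.mk _ (X j.1)
  have hx : AlgebraicIndependent k x := by
    rw [algebraicIndependent_iff]
    intro h hh
    have hfac : aeval x h = Ideal.Quotient.mk (Ideal.span {f}) (rename Subtype.val h) := by
      have : aeval x = (Ideal.Quotient.mkₐ k (Ideal.span {f})).comp (rename Subtype.val) := by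
        ext j; simp [x]
      rw [this]; rfl
    rw [hfac, Ideal.Quotient.eq_zero_iff_mem, Ideal.mem_span_singleton] at hh
    obtain ⟨g, hg⟩ := hh
    by_contra h0
    have hr0 : rename (Subtype.val : {j // j ≠ i} → Fin n) h ≠ 0 := fun h' =>
      h0 (rename_injective _ Subtype.val_injective (h'.trans (map_zero _).symm))
    have hg0 : g ≠ 0 := by rintro rfl; simp [hr0] at hg
    have hd := congrArg (degreeOf i) hg
    rw [degreeOf_mul_eq hf.ne_zero hg0] at hd
    have : degreeOf i (rename (Subtype.val : {j // j ≠ i} → Fin n) h) = 0 := by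
      rw [← Nat.le_zero, degreeOf_le_iff]
      intro m hm
      have := mt (mem_vars_rename (Subtype.val : {j // j ≠ i} → Fin n) h (j := i)) (by simp)
      by_contra! hmi
      exact this (mem_vars_iff_mem_support i |>.mpr ⟨m, hm, Finsupp.mem_support_iff.mpr hmi.ne'⟩)
    omega
  obtain ⟨m, hm, hm'⟩ :=
    exists_ringKrullDim_eq_trdeg_eq k (R := MvPolynomial (Fin n) k ⧸ Ideal.span {f})
  have hle := hx.lift_cardinalMk_le_trdeg
  rw [hm'] at hle
  simp at hle
  rw [hm]
  have : n ≤ m + 1 := by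
    have h2 : ((n - 1 : ℕ) : Cardinal.{0}) ≤ m := by simpa using hle
    have := Nat.cast_le.mp h2
    omega
  exact_mod_cast this

theorem ringKrullDim_le_quotient_add_one_of_mem_minimalPrimes (k : Type*) {R : Type*} [Field k]
    [CommRing R] [IsDomain R] [Algebra k R] [Algebra.FiniteType k R] {c : R} (hc : c ≠ 0)
    {Q : Ideal R} (hQ : Q ∈ (Ideal.span {c}).minimalPrimes) :
    ringKrullDim R ≤ ringKrullDim (R ⧸ Q) + 1 := by
  obtain ⟨n, g, hg, hfin⟩ := exists_finite_inj_algHom_of_fg k R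
  algebraize [g.toRingHom]
  have : Module.Finite (MvPolynomial (Fin n) k) R := hfin
  have : FaithfulSMul (MvPolynomial (Fin n) k) R :=
    (faithfulSMul_iff_algebraMap_injective _ _).mpr hg
  have := Algebra.FiniteType.isNoetherianRing k R
  have hQp : Q.IsPrime := hQ.1.1
  have hQ1 : Q.height ≤ 1 := Ideal.height_le_one_of_isPrincipal_of_mem_minimalPrimes _ _ hQ
  have hcQ : c ∈ Q := hQ.1.2 (Ideal.mem_span_singleton_self c)
  let q := Q.under (MvPolynomial (Fin n) k)
  have hq1 : q.height ≤ 1 := by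
    refine le_trans ?_ hQ1
    rw [Ideal.height_eq_height_add_of_liesOver_of_hasGoingDown q Q]
    exact le_self_add
  have hq0 : q ≠ ⊥ := fun h => hc (by
    have := Ideal.eq_bot_of_comap_eq_bot (R := MvPolynomial (Fin n) k) (I := Q) h
    simpa [this] using hcQ)
  have hqp : q.IsPrime := inferInstance
  obtain ⟨f, hfq, hf⟩ := hqp.exists_mem_prime_of_ne_bot hq0
  have hfp : (Ideal.span {f}).IsPrime := (Ideal.span_singleton_prime hf.ne_zero).mpr hf
  have hqf : q = Ideal.span {f} := by
    by_contra hne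
    have h1 : Ideal.span {f} < q :=
      lt_of_le_of_ne ((Ideal.span_singleton_le_iff_mem _).mpr hfq) (Ne.symm hne)
    have h0 : (⊥ : Ideal (MvPolynomial (Fin n) k)) < Ideal.span {f} :=
      bot_lt_iff_ne_bot.mpr (by simpa using hf.ne_zero)
    have h2 := Ideal.height_add_one_le_of_lt_of_isPrime h1
    have h3 := Ideal.height_add_one_le_of_lt_of_isPrime h0
    have h4 : (1 + 1 : ℕ∞) ≤ 1 := by
      calc (1 + 1 : ℕ∞) ≤ (Ideal.span {f}).height + 1 := by gcongr; exact le_trans le_add_self h3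
        _ ≤ 1 := h2.trans hq1
    exact absurd h4 (by decide)
  have hdim : ringKrullDim (MvPolynomial (Fin n) k ⧸ q) = ringKrullDim (R ⧸ Q) := by
    exact ringKrullDim_eq_of_isIntegral
  rw [← hdim, hqf, ← ringKrullDim_eq_of_isIntegral (R := MvPolynomial (Fin n) k),
    MvPolynomial.ringKrullDim_of_isNoetherianRing]
  simpa using MvPolynomial.le_ringKrullDim_quotient_span_singleton hf

theorem ringKrullDim_eq_quotient_add_one_of_map_eq_top (k : Type*) {R B : Type*} [Field k]
    [CommRing R] [CommRing B] [IsDomain R] [IsDomain B] [Algebra k R] [Algebra R B]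
    [FaithfulSMul R B] [Algebra.FiniteType k R] {p : Ideal R} [hp : p.IsPrime]
    (hpB : p.map (algebraMap R B) = ⊤)
    (hB : ∀ f ∈ p, ∀ b : B, ∃ (n : ℕ) (r : R), algebraMap R B f ^ n * b = algebraMap R B r) :
    ringKrullDim R = ringKrullDim (R ⧸ p) + 1 := by
  have hp0 : p ≠ ⊥ := by
    rintro rfl
    rw [Ideal.map_bot] at hpB
    exact bot_ne_top hpB
  refine le_antisymm ?_ (ringKrullDim_quotient_succ_le_of_ne_bot hp0)
  obtain ⟨b, hb⟩ : ∃ b : B, ¬ IsIntegral R b := by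
    by_contra! h
    exact hp.ne_top ((Ideal.map_eq_top_iff _ (FaithfulSMul.algebraMap_injective R B) h).mp hpB)
  let L := FractionRing B
  have hinj : Function.Injective (algebraMap R L) := by
    rw [IsScalarTower.algebraMap_eq R B L]
    exact (IsFractionRing.injective B L).comp (FaithfulSMul.algebraMap_injective R B)
  have hRL : FaithfulSMul R L := (faithfulSMul_iff_algebraMap_injective _ _).mpr hinj
  let : Algebra k L := ((algebraMap R L).comp (algebraMap k R)).toAlgebra
  have hkRL : IsScalarTower k R L := .of_algebraMap_eq' rfl
  let β : L := algebraMap B L b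
  have hβ : ¬ IsIntegral R β := fun h =>
    hb ((isIntegral_algebraMap_iff (IsFractionRing.injective B L)).mp h)
  have hβ0 : β ≠ 0 := fun h => hβ (h ▸ isIntegral_zero)
  let c : L := β⁻¹
  have hc0 : c ≠ 0 := inv_ne_zero hβ0
  let S := Algebra.adjoin R {c}
  let γ : S := ⟨c, Algebra.subset_adjoin rfl⟩
  have hγ0 : γ ≠ 0 := fun h => hc0 (congrArg Subtype.val h)
  have hγ : Ideal.span {γ} ≠ ⊤ := fun h => by
    let : Invertible c := invertibleOfNonzero hc0
    obtain ⟨f, hf, hfc⟩ := Algebra.exists_aeval_invOf_eq_zero_of_idealMap_adjoin_sup_span_eq_top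
      c (⊥ : Ideal R) bot_ne_top (top_le_iff.mp (h.ge.trans le_sup_right))
    refine hβ ⟨f, sub_eq_zero.mp hf, ?_⟩
    rwa [invOf_eq_inv, inv_inv] at hfc
  obtain ⟨Q, hQ⟩ := Ideal.nonempty_minimalPrimes hγ
  have hQp : Q.IsPrime := hQ.1.1
  have hγQ : γ ∈ Q := hQ.1.2 (Ideal.mem_span_singleton_self γ)
  have hmul : ∀ f ∈ p, ∃ (n : ℕ) (r : R), algebraMap R L f ^ n * β = algebraMap R L r := by
    intro f hf
    obtain ⟨n, r, h⟩ := hB f hf b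
    refine ⟨n, r, ?_⟩
    simpa [← IsScalarTower.algebraMap_apply R B L, β] using congrArg (algebraMap B L) h
  have hpQ : ∀ f ∈ p, algebraMap R S f ∈ Q := by
    intro f hf
    obtain ⟨n, r, h⟩ := hmul f hf
    refine hQp.mem_of_pow_mem n ?_
    have : algebraMap R S f ^ n = algebraMap R S r * γ := by
      ext
      change algebraMap R L f ^ n = algebraMap R L r * β⁻¹
      rw [← h, mul_assoc, mul_inv_cancel₀ hβ0, mul_one]
    rw [this]
    exact Q.mul_mem_left _ hγQ
  have hcalg : IsAlgebraic R c := by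
    obtain ⟨f, hf, hf0⟩ := Submodule.exists_mem_ne_zero_of_ne_bot hp0
    obtain ⟨n, r, h⟩ := hmul f hf
    refine IsAlgebraic.inv (IsAlgebraic.of_mul (y := algebraMap R L f ^ n) ?_ ?_ ?_)
    · exact mem_nonZeroDivisors_of_ne_zero
        (pow_ne_zero _ ((map_ne_zero_iff _ hinj).mpr hf0))
    · exact (isAlgebraic_algebraMap f).pow n
    · rw [h]; exact isAlgebraic_algebraMap r
  have : Algebra.IsAlgebraic R S :=
    S.isAlgebraic_iff.mp (Algebra.isAlgebraic_adjoin_singleton_iff.mpr hcalg)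
  have : Algebra.FiniteType R S := .adjoin_of_finite (Set.finite_singleton c)
  have : Algebra.FiniteType k S := .trans ‹_› this
  have hsurj : Function.Surjective (Ideal.Quotient.lift p
      ((Ideal.Quotient.mk Q).comp (algebraMap R S))
      fun f hf => Ideal.Quotient.eq_zero_iff_mem.mpr (hpQ f hf)) := by
    refine Ideal.Quotient.lift_surjective_of_surjective _ _ ?_
    intro y
    obtain ⟨x, rfl⟩ := Ideal.Quotient.mk_surjective y
    obtain ⟨f, hf⟩ := Algebra.adjoin_eq_exists_aeval R c x
    refine ⟨f.coeff 0, ?_⟩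
    have hx : x = algebraMap R S (f.coeff 0) + γ * Polynomial.aeval γ f.divX := by
      have h1 : x = Polynomial.aeval γ f := by
        ext
        rw [← hf]
        exact (Polynomial.aeval_algebraMap_apply L γ f)
      have h2 := congrArg (Polynomial.aeval γ) (Polynomial.divX_mul_X_add f)
      simp only [map_add, map_mul, Polynomial.aeval_X, Polynomial.aeval_C] at h2
      rw [h1, ← h2]
      ring
    rw [RingHom.comp_apply, Ideal.Quotient.eq, hx]
    simpa using Q.mul_mem_right _ hγQ
  have : FaithfulSMul R S := (faithfulSMul_iff_algebraMap_injective _ _).mpr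
    fun x y h => hinj (congrArg Subtype.val h)
  calc ringKrullDim R = ringKrullDim S := ringKrullDim_eq_of_isAlgebraic k
    _ ≤ ringKrullDim (S ⧸ Q) + 1 :=
      ringKrullDim_le_quotient_add_one_of_mem_minimalPrimes k hγ0 hQ
    _ ≤ ringKrullDim (R ⧸ p) + 1 := by
      gcongr
      exact ringKrullDim_le_of_surjective _ hsurj

open AlgebraicGeometry CategoryTheory

theorem exists_isIntegral_isClosedImmersion_range_eq (X : Scheme) [QuasiSeparatedSpace X]
    {Z : Set X} (hZ : IsIrreducible Z) (hZc : IsClosed Z) :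
    ∃ (Y : Scheme) (i : Y ⟶ X), IsIntegral Y ∧ IsClosedImmersion i ∧ Set.range i = Z := by
  obtain ⟨x, hx⟩ := QuasiSober.sober hZ hZc
  let f := X.fromSpecResidueField x
  have : IsSchemeTheoreticallyDominant f.toImage := by
    have hU : ⨆ U : X.affineOpens, f.imageι ⁻¹ᵁ U.1 = ⊤ := by
      rw [← Scheme.Hom.preimage_iSup, iSup_affineOpens_eq_top X]
      rfl
    refine ⟨Scheme.IdealSheafData.ext_of_iSup_eq_top
      (fun U : X.affineOpens => ⟨f.imageι ⁻¹ᵁ U.1, U.2.preimage _⟩) hU fun U => ?_⟩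
    simpa [Scheme.Hom.ker_apply, ← RingHom.injective_iff_ker_eq_bot] using
      f.toImage_app_injective U
  have hr : IsReduced f.image := IsSchemeTheoreticallyDominant.isReduced f.toImage
  have hrange : Set.range f.imageι = Z := by
    rw [Scheme.IdealSheafData.range_subschemeι, Scheme.Hom.support_ker,
      X.range_fromSpecResidueField x, hx.def]
  have : IrreducibleSpace f.image := by
    let g := f.toImage
    have hg : DenseRange g := IsDominant.denseRange (f := g)
    rw [irreducibleSpace_def, Set.top_eq_univ, ← hg.closure_range]
    refine IsIrreducible.closure ?_
    rw [← Set.image_univ]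
    exact (IrreducibleSpace.isIrreducible_univ _).image _ g.continuous.continuousOn
  exact ⟨f.image, f.imageι, isIntegral_of_irreducibleSpace_of_isReduced _, inferInstance, hrange⟩

theorem topologicalKrullDim_le_of_forall_exists_open {Y : Type*} [TopologicalSpace Y]
    {d : WithBot ℕ∞}
    (h : ∀ y : Y, ∃ U : TopologicalSpace.Opens Y, y ∈ U ∧ topologicalKrullDim U ≤ d) :
    topologicalKrullDim Y ≤ d := by
  cases isEmpty_or_nonempty (TopologicalSpace.IrreducibleCloseds Y) with
  | inl _ => exact Order.krullDim_eq_bot.trans_le bot_le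
  | inr _ =>
  rw [topologicalKrullDim, Order.krullDim_eq_iSup_coheight]
  refine iSup_le fun Z => ?_
  obtain ⟨y, hy⟩ := Z.2.nonempty
  obtain ⟨U, hyU, hU⟩ := h y
  have hemb : Topology.IsOpenEmbedding (Subtype.val : U → Y) := U.2.isOpenEmbedding_subtypeVal
  have hZU : ((Subtype.val : U → Y) ⁻¹' Z).Nonempty := ⟨⟨y, hyU⟩, hy⟩
  let e := TopologicalSpace.IrreducibleCloseds.orderIsoOfIsOpenEmbedding _ hemb
  let Z' := e.symm ⟨Z, hZU⟩
  have hZ : TopologicalSpace.IrreducibleCloseds.map _ hemb.continuous Z' = Z :=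
    congrArg Subtype.val (e.apply_symm_apply ⟨Z, hZU⟩)
  rw [← hZ, hemb.coheight_map]
  exact (Order.coheight_le_krullDim Z').trans hU

theorem AlgebraicGeometry.IsAffineOpen.topologicalKrullDim_eq {X : Scheme} {U : X.Opens}
    (hU : IsAffineOpen U) : topologicalKrullDim U = ringKrullDim Γ(X, U) := by
  rw [← PrimeSpectrum.topologicalKrullDim_eq_ringKrullDim]
  exact (hU.isoSpec.hom.homeomorph.isHomeomorph).topologicalKrullDim_eq

theorem exists_ringHom_finiteType {k : Type} [Field k] {Y : Scheme}
    (q : Y ⟶ Spec (CommRingCat.of k)) [LocallyOfFiniteType q] {V : Y.Opens} (hV : IsAffineOpen V) :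
    ∃ φ : k →+* Γ(Y, V), φ.FiniteType := by
  refine ⟨(q.appLE ⊤ V le_top).hom.comp (Scheme.ΓSpecIso (CommRingCat.of k)).inv.hom, ?_⟩
  exact (q.finiteType_appLE (isAffineOpen_top _) hV le_top).comp (.of_surjective _
    (Scheme.ΓSpecIso (CommRingCat.of k)).symm.commRingCatIsoToRingEquiv.surjective)

theorem ringKrullDim_basicOpen_eq {k : Type} [Field k] {Y : Scheme} [IsIntegral Y]
    (q : Y ⟶ Spec (CommRingCat.of k)) [LocallyOfFiniteType q] {V : Y.Opens} (hV : IsAffineOpen V)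
    (f : Γ(Y, V)) [Nonempty (Y.basicOpen f)] :
    ringKrullDim Γ(Y, V) = ringKrullDim Γ(Y, Y.basicOpen f) := by
  have : Nonempty V := .map (Set.inclusion (Y.basicOpen_le f)) ‹_›
  obtain ⟨φ, hφ⟩ := exists_ringHom_finiteType q hV
  algebraize [φ]
  let : Algebra k Γ(Y, Y.basicOpen f) :=
    ((algebraMap Γ(Y, V) Γ(Y, Y.basicOpen f)).comp φ).toAlgebra
  have : IsScalarTower k Γ(Y, V) Γ(Y, Y.basicOpen f) := .of_algebraMap_eq' rfl
  have := hV.isLocalization_basicOpen f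
  have : FaithfulSMul Γ(Y, V) Γ(Y, Y.basicOpen f) :=
    (faithfulSMul_iff_algebraMap_injective _ _).mpr
      (map_injective_of_isIntegral Y (homOfLE (Y.basicOpen_le f)))
  have := IsLocalization.isAlgebraic Γ(Y, Y.basicOpen f) (.powers f)
  have : Algebra.FiniteType Γ(Y, V) Γ(Y, Y.basicOpen f) :=
    IsLocalization.finiteType_of_monoid_fg (.powers f) _
  have : Algebra.FiniteType k Γ(Y, Y.basicOpen f) := .trans ‹_› this
  exact ringKrullDim_eq_of_isAlgebraic k

theorem topologicalKrullDim_eq_ringKrullDim_of_isIntegral {k : Type} [Field k] {Y : Scheme}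
    [IsIntegral Y] (q : Y ⟶ Spec (CommRingCat.of k)) [LocallyOfFiniteType q] {V : Y.Opens}
    (hV : IsAffineOpen V) [Nonempty V] : topologicalKrullDim Y = ringKrullDim Γ(Y, V) := by
  refine le_antisymm (topologicalKrullDim_le_of_forall_exists_open fun y => ?_) ?_
  · obtain ⟨_, ⟨W, hW, rfl⟩, hyW, -⟩ :=
      Y.isBasis_affineOpens.exists_subset_of_mem_open (Set.mem_univ y) isOpen_univ
    refine ⟨W, hyW, ?_⟩
    obtain ⟨z, -, hzV, hzW⟩ := (IrreducibleSpace.isIrreducible_univ Y).2 V W V.2 W.2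
      (by simpa [Set.nonempty_coe_sort] using ‹Nonempty V›) ⟨y, trivial, hyW⟩
    obtain ⟨f, g, hfg, hz⟩ := exists_basicOpen_le_affine_inter hV hW z ⟨hzV, hzW⟩
    have : Nonempty (Y.basicOpen f) := ⟨z, hz⟩
    have : Nonempty (Y.basicOpen g) := hfg ▸ this
    refine (IsAffineOpen.topologicalKrullDim_eq hW).le.trans ?_
    rw [ringKrullDim_basicOpen_eq q hV f, ringKrullDim_basicOpen_eq q hW g, hfg]
  · rw [← hV.topologicalKrullDim_eq]
    exact V.isOpenEmbedding.isInducing.topologicalKrullDim_le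

theorem ringKrullDim_eq_quotient_add_one_of_isAffineOpen {k : Type} [Field k] {Y : Scheme}
    [IsIntegral Y] (q : Y ⟶ Spec (CommRingCat.of k)) [LocallyOfFiniteType q] {V D : Y.Opens}
    (hV : IsAffineOpen V) (hD : IsAffineOpen D) (hDV : D ≤ V) [Nonempty D]
    {p : Ideal Γ(Y, V)} [p.IsPrime] (hp : ∀ x ∈ V, x ∈ D ↔ x ∉ Y.zeroLocus (U := V) p) :
    ringKrullDim Γ(Y, V) = ringKrullDim (Γ(Y, V) ⧸ p) + 1 := by
  have : Nonempty V := .map (Set.inclusion hDV) ‹_›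
  obtain ⟨φ, hφ⟩ := exists_ringHom_finiteType q hV
  algebraize [φ]
  let ρ := (Y.presheaf.map (homOfLE hDV).op).hom
  have hρ : Function.Injective ρ := map_injective_of_isIntegral Y (homOfLE hDV)
  have hle : ∀ f ∈ p, Y.basicOpen f ≤ D := fun f hf x hx =>
    (hp x (Y.basicOpen_le f hx)).mpr fun h => (Y.mem_zeroLocus_iff _ x).mp h f hf hx
  let : Algebra Γ(Y, V) Γ(Y, D) := ρ.toAlgebra
  have : FaithfulSMul Γ(Y, V) Γ(Y, D) := (faithfulSMul_iff_algebraMap_injective _ _).mpr hρ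
  refine ringKrullDim_eq_quotient_add_one_of_map_eq_top k (B := Γ(Y, D)) ?_ fun f hf b => ?_
  · rw [Ideal.map, ← hD.iSup_basicOpen_eq_self_iff]
    refine le_antisymm (iSup_le fun f => Y.basicOpen_le _) fun x hx => ?_
    have := (hp x (hDV hx)).mp hx
    rw [Y.mem_zeroLocus_iff] at this
    push Not at this
    obtain ⟨f, hf, hxf⟩ := this
    refine TopologicalSpace.Opens.mem_iSup.mpr ⟨⟨ρ f, f, hf, rfl⟩, ?_⟩
    exact (Y.basicOpen_res f (homOfLE hDV).op).ge ⟨hx, hxf⟩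
  · rcases eq_or_ne f 0 with rfl | hf0
    · exact ⟨1, 0, by simp⟩
    have : Nonempty (Y.basicOpen f) := by
      by_contra h
      exact hf0 ((basicOpen_eq_bot_iff f).mp (by simpa [Set.not_nonempty_iff_eq_empty] using h))
    have := hV.isLocalization_basicOpen f
    let σ := (Y.presheaf.map (homOfLE (hle f hf)).op).hom
    obtain ⟨n, r, h⟩ := IsLocalization.Away.surj f (σ b)
    refine ⟨n, r, map_injective_of_isIntegral Y (homOfLE (hle f hf)) ?_⟩
    have hσ : ∀ a : Γ(Y, V), σ (ρ a) = algebraMap Γ(Y, V) Γ(Y, Y.basicOpen f) a := fun a => by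
      change (Y.presheaf.map _ ≫ Y.presheaf.map _).hom a = _
      rw [← Functor.map_comp]
      rfl
    change σ (ρ f ^ n * b) = σ (ρ r)
    rw [map_mul, map_pow, hσ, hσ, mul_comm]
    exact h

theorem topologicalKrullDim_eq_add_one_of_isClosedImmersion {k : Type} [Field k] {W Y : Scheme}
    [IsIntegral W] [IsIntegral Y] (q : Y ⟶ Spec (CommRingCat.of k)) [LocallyOfFiniteType q]
    (j : W ⟶ Y) [IsClosedImmersion j] {V D : Y.Opens}
    (hV : IsAffineOpen V) (hD : IsAffineOpen D) (hDV : D ≤ V) [Nonempty D]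
    (hVj : Nonempty (j ⁻¹ᵁ V)) (hj : ∀ x ∈ V, x ∈ D ↔ x ∉ Set.range j) :
    topologicalKrullDim Y = topologicalKrullDim W + 1 := by
  have : Nonempty V := .map (Set.inclusion hDV) ‹_›
  let p := RingHom.ker (j.app V).hom
  have : p.IsPrime := RingHom.ker_isPrime _
  have hp : ∀ x ∈ V, x ∈ D ↔ x ∉ Y.zeroLocus (U := V) p := fun x hx => by
    have := Scheme.IdealSheafData.mem_support_iff_of_mem (I := j.ker) (U := ⟨V, hV⟩) hx
    rw [Scheme.Hom.ker_apply, ← SetLike.mem_coe, Scheme.Hom.support_ker,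
      j.isClosedEmbedding.isClosed_range.closure_eq] at this
    rw [hj x hx, this]
  rw [topologicalKrullDim_eq_ringKrullDim_of_isIntegral q hV,
    topologicalKrullDim_eq_ringKrullDim_of_isIntegral (j ≫ q) (hV.preimage j),
    ringKrullDim_eq_quotient_add_one_of_isAffineOpen q hV hD hDV hp,
    ringKrullDim_eq_of_ringEquiv
      (RingHom.quotientKerEquivOfSurjective (j.app_surjective V hV))]

theorem exists_isAffineOpen_mem_inter_subset (X : Scheme) [TopologicalSpace.NoetherianSpace X]
    {A Z : Set X} (hA : IsClosed A) (hZ : IsIrreducible Z) (hZA : Z ⊆ A)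
    (hmax : ∀ s : Set X, IsIrreducible s → s ⊆ A → Z ⊆ s → s = Z) :
    IsClosed Z ∧ ∃ U : X.Opens, IsAffineOpen U ∧ (Z ∩ U).Nonempty ∧ A ∩ U ⊆ Z := by
  have hZc : IsClosed Z := by
    rw [← hmax _ hZ.closure (hA.closure_subset_iff.mpr hZA) subset_closure]
    exact isClosed_closure
  obtain ⟨S, hS, hSc, hSi, hAS⟩ :=
    TopologicalSpace.NoetherianSpace.exists_finite_set_isClosed_irreducible hA
  obtain ⟨x, hx⟩ := QuasiSober.sober hZ hZc
  let C := ⋃₀ (S \ {Z})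
  have hC : IsClosed C := by
    rw [show C = _ from Set.sUnion_eq_biUnion]
    exact hS.sdiff.isClosed_biUnion fun t ht => hSc t ht.1
  have hxC : x ∈ Cᶜ := by
    rintro ⟨t, ⟨htS, htZ⟩, hxt⟩
    exact htZ (hmax t (hSi t htS) (hAS ▸ Set.subset_sUnion_of_mem htS)
      (hx.mem_closed_set_iff (hSc t htS) |>.mp hxt))
  obtain ⟨_, ⟨U, hU, rfl⟩, hxU, hUC⟩ :=
    X.isBasis_affineOpens.exists_subset_of_mem_open hxC hC.isOpen_compl
  refine ⟨hZc, U, hU, ⟨x, hx.mem, hxU⟩, fun y ⟨hyA, hyU⟩ => ?_⟩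
  rw [hAS] at hyA
  obtain ⟨t, htS, hyt⟩ := hyA
  by_contra hyZ
  exact hUC hyU ⟨t, ⟨htS, fun h => hyZ (h ▸ hyt)⟩, hyt⟩

/-!
STATEMENT 14: Let k be a field, X a separated scheme of finite type over k, X₀ ⊆ X a closed
subset whose open complement is affine.  Let Z₁ be an irreducible component of X with
Z₁ ⊄ X₀ and Z₁ ∩ X₀ ≠ ∅, and let Z₀ be an irreducible component of Z₁ ∩ X₀.  Then
dim Z₁ = dim Z₀ + 1 (Krull dimension of the underlying topological spaces).
-/

theorem statement14 (k : Type) [Field k] (X : Scheme)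
    (q : X ⟶ Spec (CommRingCat.of k))
    [LocallyOfFiniteType q] [QuasiCompact q] [IsSeparated q]
    (X₀ : Set X) (hX₀ : IsClosed X₀)
    (haff : IsAffineOpen (⟨X₀ᶜ, hX₀.isOpen_compl⟩ : X.Opens))
    (Z₁ : Set X) (hZ₁ : Z₁ ∈ irreducibleComponents X)
    (hZ₁n : ¬ Z₁ ⊆ X₀) (hne : (Z₁ ∩ X₀).Nonempty)
    (Z₀ : Set X) (hZ₀irr : IsIrreducible Z₀) (hZ₀sub : Z₀ ⊆ Z₁ ∩ X₀)
    (hZ₀max : ∀ s : Set X, IsIrreducible s → s ⊆ Z₁ ∩ X₀ → Z₀ ⊆ s → s = Z₀) :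
    topologicalKrullDim Z₁ = topologicalKrullDim Z₀ + 1 := by
  have : IsLocallyNoetherian X := LocallyOfFiniteType.isLocallyNoetherian q
  have : CompactSpace X := QuasiCompact.compactSpace_of_compactSpace q
  have : IsNoetherian X := {}
  have : X.IsSeparated := ⟨by
    rw [show Limits.terminal.from X = q ≫ Limits.terminal.from _ from Subsingleton.elim _ _]
    infer_instance⟩
  have hZ₁c : IsClosed Z₁ := isClosed_of_mem_irreducibleComponents _ hZ₁
  have hZ₁i : IsIrreducible Z₁ := hZ₁.1
  obtain ⟨hZ₀c, U, hU, hUZ₀, hUA⟩ := exists_isAffineOpen_mem_inter_subset X (hZ₁c.inter hX₀)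
    hZ₀irr hZ₀sub hZ₀max
  obtain ⟨Y, i, _, _, rfl⟩ := exists_isIntegral_isClosedImmersion_range_eq X hZ₁i hZ₁c
  have : IsLocallyNoetherian Y := LocallyOfFiniteType.isLocallyNoetherian (i ≫ q)
  have hi := i.isClosedEmbedding
  have hir : IsIrreducible (i ⁻¹' Z₀) := by
    obtain ⟨x, hx⟩ := QuasiSober.sober hZ₀irr hZ₀c
    obtain ⟨y, rfl⟩ := (hZ₀sub hx.mem).1
    rw [← hx.def, ← Set.image_singleton, ← hi.closure_eq_preimage_closure_image]
    exact isIrreducible_singleton.closure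
  obtain ⟨W, j, _, _, hj⟩ := exists_isIntegral_isClosedImmersion_range_eq Y hir
    (hZ₀c.preimage i.continuous)
  have hji : Set.range (j ≫ i) = Z₀ := by
    rw [Scheme.Hom.comp_base, TopCat.coe_comp, Set.range_comp, hj,
      Set.image_preimage_eq_of_subset fun x hx => (hZ₀sub hx).1]
  have h₁ : topologicalKrullDim (Set.range i) = topologicalKrullDim Y :=
    (hi.isEmbedding.toHomeomorph.isHomeomorph.topologicalKrullDim_eq).symm
  have h₀ : topologicalKrullDim Z₀ = topologicalKrullDim W := by
    rw [← hji]
    have hemb := (j ≫ i).isClosedEmbedding.isEmbedding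
    exact hemb.toHomeomorph.isHomeomorph.topologicalKrullDim_eq.symm
  let D : X.Opens := U ⊓ ⟨X₀ᶜ, hX₀.isOpen_compl⟩
  have hD : IsAffineOpen D := hU.inf haff
  obtain ⟨x, hxZ₀, hxU⟩ := hUZ₀
  have : Nonempty (i ⁻¹ᵁ D) := by
    obtain ⟨_, ⟨y, rfl⟩, hy⟩ := hZ₁i.2 U X₀ᶜ U.2 hX₀.isOpen_compl ⟨x, (hZ₀sub hxZ₀).1, hxU⟩
      (Set.not_subset.mp hZ₁n)
    exact ⟨y, hy⟩
  rw [h₀, h₁]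
  refine topologicalKrullDim_eq_add_one_of_isClosedImmersion (i ≫ q) j (hU.preimage i)
    (hD.preimage i) (i.preimage_mono inf_le_left) ?_ fun y hy => ?_
  · obtain ⟨w, rfl⟩ := hji.ge hxZ₀
    exact ⟨w, hxU⟩
  · rw [hj]
    refine ⟨fun h h' => h.2 (hZ₀sub h').2, fun h => ⟨hy, fun h' => h (hUA ⟨⟨⟨y, rfl⟩, h'⟩, hy⟩)⟩⟩
end

section
/- Every affine group scheme over a field of characteristic zero is formally smooth. More precisely, if k is a field with char(k) = 0 and G = Spec(A) is an affine group scheme over k (A a commutative Hopf algebra over k), then A is formally smooth over k, i.e., for every k-algebra R and every square-zero ideal I ⊆ R, every k-algebra map A → R/I lifts to a k-algebra map A → R. -/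
section
open MvPolynomial

theorem Derivation.mem_pow_of_mem_pow_succ {k B : Type*} [CommRing k] [CommRing B] [Algebra k B]
    (D : Derivation k B B) (I : Ideal B) (n : ℕ) {b : B} (hb : b ∈ I ^ (n + 1)) :
    D b ∈ I ^ n := by
  induction n generalizing b with
  | zero => simp
  | succ n ih =>
    rw [pow_succ'] at hb
    induction hb using Submodule.mul_induction_on' with
    | mem_mul_mem x hx y hy =>
      rw [D.leibniz]
      refine add_mem ?_ (Ideal.mul_mem_right _ _ hy)
      rw [pow_succ']
      exact Ideal.mul_mem_mul hx (ih hy)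
    | add x _ y _ hx hy => rw [map_add]; exact add_mem hx hy

theorem MvPolynomial.aeval_mem_pow_of_isHomogeneous {k B ι : Type*} [Field k] [CommRing B]
    [Algebra k B] (I : Ideal B) (x : ι → B) (hx : ∀ i, x i ∈ I) {d : ℕ}
    {P : MvPolynomial ι k} (hP : P.IsHomogeneous d) : aeval x P ∈ I ^ d := by
  classical
  rw [P.as_sum, map_sum]
  refine sum_mem fun s hs ↦ ?_
  have hs' : s.degree = d := by
    rw [← hP (mem_support_iff.mp hs)]; exact (congr($(Finsupp.degree_eq_weight_one (R := ℕ)) s))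
  rw [← mul_one (P.coeff s), ← smul_eq_mul, ← smul_monomial, map_smul, Algebra.smul_def]
  rw [aeval_monomial, ← hs']
  refine Ideal.mul_mem_left _ _ (Ideal.mul_mem_left _ _ ?_)
  rw [Finsupp.prod, Finsupp.degree_apply, ← Finset.prod_pow_eq_pow_sum]
  exact Ideal.prod_mem_prod fun i _ ↦ Ideal.pow_mem_pow (hx i) _

theorem derivation_aeval_monomial_sub_pderiv_mem {k B ι : Type*} [Field k] [CommRing B]
    [Algebra k B] [DecidableEq ι] (I : Ideal B) (x : ι → B) (hx : ∀ i, x i ∈ I) (i : ι)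
    (D : Derivation k B B) (hD : ∀ j, D (x j) - Pi.single (M := fun _ ↦ B) i 1 j ∈ I) (d : ℕ) :
    ∀ s : ι →₀ ℕ, s.degree = d →
      D (aeval x (monomial s (1 : k))) - aeval x (pderiv i (monomial s (1 : k))) ∈ I ^ d := by
  induction d with
  | zero => intro s hs; simp
  | succ d ih =>
    intro s hs
    have hs0 : s ≠ 0 := by rintro rfl; simp at hs
    obtain ⟨j, hj⟩ := Finsupp.ne_iff.mp hs0
    obtain ⟨t, rfl⟩ : ∃ t, s = t + Finsupp.single j 1 :=
      ⟨s - Finsupp.single j 1, (tsub_add_cancel_of_le (by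
        rw [Finsupp.single_le_iff]; exact Nat.one_le_iff_ne_zero.mpr hj)).symm⟩
    have ht : t.degree = d := by simpa [map_add] using hs
    have h1 : aeval x (monomial t (1 : k)) ∈ I ^ d :=
      aeval_mem_pow_of_isHomogeneous I x hx (isHomogeneous_monomial _ ht)
    have h2 := ih t ht
    have e : (monomial (t + Finsupp.single j 1) (1 : k)) = monomial t 1 * X j := by
      simp [X, monomial_mul]
    rw [e, map_mul, aeval_X]
    have e2 : aeval x (pderiv i (X j : MvPolynomial ι k)) = Pi.single (M := fun _ ↦ B) i 1 j := by
      rw [pderiv_X, Pi.single_apply, Pi.single_apply]; split_ifs <;> simp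
    rw [D.leibniz, pderiv_mul, map_add, map_mul, map_mul, aeval_X, e2]
    simp only [smul_eq_mul]
    rw [show ∀ a b c d e f : B, a * b + c * d - (e * c + a * f) = a * (b - f) + (d - e) * c by
      intros; ring, pow_succ]
    exact add_mem (Ideal.mul_mem_mul h1 (hD j)) (Ideal.mul_mem_mul h2 (hx j))

theorem MvPolynomial.derivation_aeval_sub_pderiv_mem {k B ι : Type*} [Field k] [CommRing B]
    [Algebra k B] [DecidableEq ι] (I : Ideal B) (x : ι → B) (hx : ∀ i, x i ∈ I) (i : ι)
    (D : Derivation k B B) (hD : ∀ j, D (x j) - Pi.single (M := fun _ ↦ B) i 1 j ∈ I) {d : ℕ}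
    {P : MvPolynomial ι k} (hP : P.IsHomogeneous d) :
    D (aeval x P) - aeval x (pderiv i P) ∈ I ^ d := by
  rw [P.as_sum, map_sum, map_sum, map_sum, map_sum, ← Finset.sum_sub_distrib]
  refine sum_mem fun s hs ↦ ?_
  have hs' : s.degree = d := by
    rw [← hP (mem_support_iff.mp hs)]; exact (congr($(Finsupp.degree_eq_weight_one (R := ℕ)) s))
  rw [← mul_one (P.coeff s), ← smul_eq_mul, ← smul_monomial, map_smul, Derivation.map_smul,
    Derivation.map_smul, map_smul, ← smul_sub, Algebra.smul_def]
  exact Ideal.mul_mem_left _ _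
    (derivation_aeval_monomial_sub_pderiv_mem I x hx i D hD d s hs')

theorem MvPolynomial.eq_zero_of_forall_pderiv_eq_zero {k ι : Type*} [Field k] [CharZero k] {d : ℕ}
    {P : MvPolynomial ι k} (hP : P.IsHomogeneous (d + 1)) (h : ∀ i, pderiv i P = 0) : P = 0 := by
  classical
  ext s
  by_contra hs
  rw [coeff_zero] at hs
  have hs' : s.degree = d + 1 := by
    rw [← hP hs]; exact (congr($(Finsupp.degree_eq_weight_one (R := ℕ)) s))
  have hs0 : s ≠ 0 := by rintro rfl; simp at hs'
  obtain ⟨j, hj⟩ := Finsupp.ne_iff.mp hs0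
  obtain ⟨t, rfl⟩ : ∃ t, s = t + Finsupp.single j 1 :=
    ⟨s - Finsupp.single j 1, (tsub_add_cancel_of_le (by
      rw [Finsupp.single_le_iff]; exact Nat.one_le_iff_ne_zero.mpr hj)).symm⟩
  have := congr_arg (coeff t) (h j)
  rw [coeff_pderiv, coeff_zero] at this
  rcases mul_eq_zero.mp this with h | h
  · exact hs h
  · exact Nat.cast_add_one_ne_zero (t j) h

/-- If `B` has derivations dual to the family `x` modulo the augmentation ideal, then in
characteristic zero the monomials of degree `d` in `x` are independent modulo the `d + 1`-st power
of the augmentation ideal. -/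
theorem MvPolynomial.eq_zero_of_aeval_mem_pow_succ {k B ι : Type*} [Field k] [CharZero k]
    [CommRing B] [Algebra k B] [DecidableEq ι] (ε : B →ₐ[k] k) (x : ι → B) (hx : ∀ i, ε (x i) = 0)
    (D : ι → Derivation k B B) (hD : ∀ i j, ε (D i (x j)) = if i = j then 1 else 0) {d : ℕ}
    {P : MvPolynomial ι k} (hP : P.IsHomogeneous d) (h : aeval x P ∈ RingHom.ker ε ^ (d + 1)) :
    P = 0 := by
  induction d generalizing P with
  | zero =>
    obtain ⟨c, rfl⟩ : ∃ c, P = C c :=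
      ⟨_, totalDegree_eq_zero_iff_eq_C.mp (hP.totalDegree_le.antisymm (Nat.zero_le _))⟩
    simpa using h
  | succ d ih =>
    refine MvPolynomial.eq_zero_of_forall_pderiv_eq_zero hP fun i ↦
      ih (by simpa using hP.pderiv (i := i)) ?_
    have h1 := (D i).mem_pow_of_mem_pow_succ _ _ h
    have h2 := derivation_aeval_sub_pderiv_mem (RingHom.ker ε) x hx i (D i)
      (fun j ↦ by
        rw [RingHom.mem_ker, map_sub, hD, Pi.single_apply]
        by_cases hij : i = j
        · simp [hij]
        · simp [hij, Ne.symm hij]) hP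
    simpa using sub_mem h1 h2

/-- Graded pieces of the augmentation ideal of a small extension are spanned by monomials. -/
theorem exists_homogeneous_sub_mem_pow_succ {k E ι : Type*} [Field k] [CommRing E] [Algebra k E]
    (η : E →ₐ[k] k) (N : Ideal E) (hN : ∀ t ∈ N, ∀ y, η y = 0 → y * t = 0)
    (e : ι → E) (he : ∀ i, η (e i) = 0)
    (hspan : ∀ y, η y = 0 → ∃ P : MvPolynomial ι k, P.IsHomogeneous 1 ∧ ∃ t ∈ N,
      y - aeval e P - t ∈ RingHom.ker η ^ 2) (n : ℕ) {z : E} (hz : z ∈ RingHom.ker η ^ n) :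
    ∃ P : MvPolynomial ι k, P.IsHomogeneous n ∧ ∃ t ∈ N, (2 ≤ n → t = 0) ∧
      z - aeval e P - t ∈ RingHom.ker η ^ (n + 1) := by
  induction n generalizing z with
  | zero =>
    refine ⟨C (η z), isHomogeneous_C _ _, 0, zero_mem _, by simp, ?_⟩
    simp [RingHom.mem_ker]
  | succ n ih =>
    rw [pow_succ'] at hz
    induction hz using Submodule.mul_induction_on' with
    | mem_mul_mem y hy z hz =>
      obtain ⟨L, hL, t, ht, hw⟩ := hspan y hy
      obtain ⟨P, hP, t', ht', -, hw'⟩ := ih hz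
      refine ⟨L * P, by rw [add_comm n]; exact hL.mul hP, t * z, N.mul_mem_right _ ht, ?_, ?_⟩
      · intro hn
        rw [mul_comm]
        exact hN t ht z (Ideal.pow_le_self (by omega) hz)
      · have hLJ : η (aeval e L) = 0 := by
          have := aeval_mem_pow_of_isHomogeneous (RingHom.ker η) e he hL
          simpa using this
        have h0 := hN t' ht' _ hLJ
        rw [map_mul, show y * z - aeval e L * aeval e P - t * z =
          (y - aeval e L - t) * z + aeval e L * (z - aeval e P - t') by
            linear_combination h0]
        refine add_mem ?_ ?_
        · rw [show n + 1 + 1 = 2 + n by ring, pow_add]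
          exact Ideal.mul_mem_mul hw hz
        · rw [pow_succ' _ (n + 1)]
          exact Ideal.mul_mem_mul hLJ hw'
    | add y _ z _ hy hz =>
      obtain ⟨P, hP, t, ht, h, hw⟩ := hy
      obtain ⟨P', hP', t', ht', h', hw'⟩ := hz
      refine ⟨P + P', hP.add hP', t + t', add_mem ht ht', fun hn ↦ by simp [h hn, h' hn], ?_⟩
      have := add_mem hw hw'
      rw [map_add]
      convert this using 1
      ring

/-- A small extension of a Noetherian augmented algebra which has enough derivations has no
tangent obstruction in characteristic zero. -/
theorem eq_zero_of_mem_ker_of_mem_sq {k E B : Type*} [Field k] [CharZero k]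
    [CommRing E] [Algebra k E] [IsNoetherianRing E] [CommRing B] [Algebra k B]
    (π : E →ₐ[k] B) (hπ : Function.Surjective π) (ε : B →ₐ[k] k)
    (hker : ∀ t, π t = 0 → ∀ y, ε (π y) = 0 → y * t = 0)
    (hder : ∀ δ : B →ₗ[k] k, (∀ a b, δ (a * b) = ε a * δ b + ε b * δ a) →
      ∃ D : Derivation k B B, ∀ b, ε (D b) = δ b)
    {z : E} (hz : π z = 0) (hz2 : z ∈ RingHom.ker (ε.comp π) ^ 2) : z = 0 := by
  classical
  set I := RingHom.ker ε with hI
  set η := ε.comp π with hη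
  set J := RingHom.ker η with hJ
  have hmap : ∀ n, (J ^ n).map π = I ^ n := fun n ↦ by
    rw [Ideal.map_pow]
    congr 1
    refine le_antisymm (Ideal.map_le_iff_le_comap.mpr fun y hy ↦ hy) fun b hb ↦ ?_
    obtain ⟨y, rfl⟩ := hπ b
    exact Ideal.mem_map_of_mem _ hb
  let W : Submodule k B := (I ^ 2).restrictScalars k ⊔ Submodule.span k {1}
  let b := Module.Basis.ofVectorSpace k (B ⧸ W)
  have hW1 : W.mkQ 1 = 0 := by
    rw [Submodule.mkQ_apply, Submodule.Quotient.mk_eq_zero]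
    exact Submodule.mem_sup_right (Submodule.mem_span_singleton_self _)
  have hW2 : ∀ y ∈ I ^ 2, W.mkQ y = 0 := fun y hy ↦ by
    rw [Submodule.mkQ_apply, Submodule.Quotient.mk_eq_zero]
    exact Submodule.mem_sup_left hy
  have hWI : ∀ y, ε y = 0 → W.mkQ y = 0 → y ∈ I ^ 2 := fun y hy hyW ↦ by
    rw [Submodule.mkQ_apply, Submodule.Quotient.mk_eq_zero] at hyW
    obtain ⟨u, hu, v, hv, rfl⟩ := Submodule.mem_sup.mp hyW
    obtain ⟨c, rfl⟩ := Submodule.mem_span_singleton.mp hv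
    have hu0 : ε u = 0 := Ideal.pow_le_self two_ne_zero hu
    have hc : c = 0 := by simpa [hu0] using hy
    simpa [hc] using hu
  have hlift : ∀ q : B ⧸ W, ∃ y : E, η y = 0 ∧ W.mkQ (π y) = q := fun q ↦ by
    obtain ⟨a, rfl⟩ := W.mkQ_surjective q
    obtain ⟨y, rfl⟩ := hπ a
    refine ⟨y - algebraMap k E (η y), by simp, ?_⟩
    rw [map_sub, AlgHom.commutes, Algebra.algebraMap_eq_smul_one, map_sub, map_smul, hW1]
    simp
  choose e he heb using fun i ↦ hlift (b i)
  have hδ : ∀ i, ∃ D : Derivation k B B, ∀ a, ε (D a) = b.repr (W.mkQ a) i := fun i ↦ by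
    refine hder (b.coord i ∘ₗ W.mkQ) fun u v ↦ ?_
    have key : W.mkQ (u * v) = ε u • W.mkQ v + ε v • W.mkQ u := by
      have h : (u - algebraMap k B (ε u)) * (v - algebraMap k B (ε v)) ∈ I ^ 2 := by
        rw [pow_two]
        exact Ideal.mul_mem_mul (by simp [hI, RingHom.mem_ker]) (by simp [hI, RingHom.mem_ker])
      have h' := hW2 _ h
      have h'' : (u - algebraMap k B (ε u)) * (v - algebraMap k B (ε v)) =
          u * v - ε u • v - ε v • u + (ε u * ε v) • (1 : B) := by
        simp only [Algebra.smul_def, map_mul]; ring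
      rw [h'', map_add, map_sub, map_sub, map_smul, map_smul, map_smul, hW1] at h'
      simp only [smul_zero, add_zero] at h'
      rw [sub_sub, sub_eq_zero] at h'
      exact h'
    simp only [LinearMap.comp_apply, key, map_add, map_smul, smul_eq_mul]
  choose D hD using hδ
  have hDx : ∀ i j, ε (D i (π (e j))) = if i = j then 1 else 0 := fun i j ↦ by
    rw [hD, heb, b.repr_self, Finsupp.single_apply]
    simp [eq_comm]
  have hspan : ∀ y, η y = 0 → ∃ P : MvPolynomial _ k, P.IsHomogeneous 1 ∧
      ∃ t ∈ RingHom.ker π, y - aeval e P - t ∈ J ^ 2 := fun y hy ↦ by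
    let c := b.repr (W.mkQ (π y))
    refine ⟨∑ i ∈ c.support, c i • X i, ?_, ?_⟩
    · exact IsHomogeneous.sum _ _ _ fun i _ ↦ by
        rw [smul_eq_C_mul]; simpa using (isHomogeneous_C _ (c i)).mul (isHomogeneous_X k i)
    · set P : MvPolynomial _ k := ∑ i ∈ c.support, c i • X i with hP
      have hPe : aeval e P = ∑ i ∈ c.support, c i • e i := by simp [hP]
      have h1 : π (y - aeval e P) ∈ I ^ 2 := by
        refine hWI _ ?_ ?_
        · change η _ = 0
          rw [map_sub, hy, hPe, map_sum]
          simp [he]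
        · rw [map_sub, map_sub, hPe, map_sum, map_sum, sub_eq_zero]
          simp only [map_smul, heb]
          exact (b.linearCombination_repr _).symm
      rw [← hmap] at h1
      obtain ⟨w, hw, hwe⟩ := (Ideal.mem_map_iff_of_surjective π hπ).mp h1
      refine ⟨y - aeval e P - w, ?_, by simpa using hw⟩
      rw [RingHom.mem_ker, map_sub π _ w, hwe, sub_self]
  have hpow : ∀ n, z ∈ J ^ (n + 2) := fun n ↦ by
    induction n with
    | zero => exact hz2
    | succ n ih =>
      obtain ⟨P, hP, t, -, ht, hw⟩ := exists_homogeneous_sub_mem_pow_succ η (RingHom.ker π)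
        hker e he hspan (n + 2) ih
      obtain rfl := ht (by omega)
      have h1 : aeval (fun i ↦ π (e i)) P ∈ I ^ (n + 2 + 1) := by
        have := Ideal.mem_map_of_mem π hw
        rw [hmap] at this
        simp only [sub_zero, map_sub, hz, zero_sub, neg_mem_iff] at this
        rwa [← AlgHom.comp_apply, comp_aeval] at this
      obtain rfl := MvPolynomial.eq_zero_of_aeval_mem_pow_succ ε _ he D hDx hP h1
      simpa using hw
  have : z ∈ (⨅ i : ℕ, J ^ i • ⊤ : Submodule E E) := by
    simp only [Submodule.mem_iInf, smul_eq_mul, Ideal.mul_top]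
    exact fun i ↦ Ideal.pow_le_pow_right (by omega) (hpow i)
  obtain ⟨r, hr⟩ := (J.mem_iInf_smul_pow_eq_bot_iff z).mp this
  rw [← hr, smul_eq_mul]
  exact hker z hz r r.2

end

section
open TensorProduct
open Coalgebra (comul counit coassoc_apply rTensor_counit_comul lTensor_counit_comul)

/-- Every element of a coalgebra over a field lies in a finite-dimensional right subcomodule. -/
theorem exists_finite_subcomodule {k A : Type*} [Field k] [AddCommGroup A] [Module k A]
    [Coalgebra k A] (a : A) :
    ∃ V : Submodule k A, FiniteDimensional k V ∧ a ∈ V ∧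
      ∀ v ∈ V, comul (R := k) v ∈ LinearMap.range (V.subtype.rTensor A) := by
  classical
  let e := Module.Basis.ofVectorSpace k A
  let T : (A →ₗ[k] k) → A ⊗[k] A →ₗ[k] A := fun φ ↦ (TensorProduct.rid k A).toLinearMap ∘ₗ
    φ.lTensor A
  have hT : ∀ φ x y, T φ (x ⊗ₜ y) = φ y • x := fun φ x y ↦ by simp [T]
  let S : (A →ₗ[k] k) →ₗ[k] A :=
    { toFun := fun φ ↦ T φ (comul a)
      map_add' := fun φ ψ ↦ by simp [T, LinearMap.lTensor_add]
      map_smul' := fun c φ ↦ by simp [T, LinearMap.lTensor_smul] }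
  have hS : ∀ φ, S φ = T φ (comul a) := fun φ ↦ rfl
  let c := TensorProduct.equivFinsuppOfBasisRight e (M := A) (comul (R := k) a)
  have hc : comul (R := k) a = ∑ i ∈ c.support, c i ⊗ₜ[k] e i := by
    change _ = c.sum fun i m ↦ m ⊗ₜ[k] e i
    rw [← TensorProduct.equivFinsuppOfBasisRight_symm_apply]
    simp [c]
  have hcS : ∀ i, c i = S (e.coord i) := fun i ↦ by
    rw [hS]
    exact TensorProduct.equivFinsuppOfBasisRight_apply ..
  have hmem : ∀ ψ : A →ₗ[k] A, ψ.lTensor A (comul (R := k) a) ∈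
      LinearMap.range ((LinearMap.range S).subtype.rTensor A) := fun ψ ↦ by
    rw [hc, map_sum]
    refine sum_mem fun i _ ↦ ⟨⟨c i, _, (hcS i).symm⟩ ⊗ₜ ψ (e i), by simp⟩
  refine ⟨LinearMap.range S, ?_, ⟨counit, ?_⟩, ?_⟩
  · refine Submodule.finiteDimensional_of_le
      (S₂ := Submodule.span k (c.support.image c : Finset A)) ?_
    rintro _ ⟨φ, rfl⟩
    rw [hS, hc, map_sum]
    refine sum_mem fun i hi ↦ ?_
    rw [hT]
    exact Submodule.smul_mem _ _ (Submodule.subset_span (by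
      rw [Finset.coe_image]
      exact ⟨i, hi, rfl⟩))
  · rw [hS]; simp [T]
  · rintro _ ⟨φ, rfl⟩
    have key : comul (R := k) (S φ) = (T φ ∘ₗ comul).lTensor A (comul (R := k) a) := by
      have h1 : ∀ t : A ⊗[k] A, comul (R := k) (T φ t) =
          (T φ).lTensor A (TensorProduct.assoc k A A A (comul.rTensor A t)) := fun t ↦ by
        induction t with
        | zero => simp
        | add x y hx hy => simp only [map_add, hx, hy]
        | tmul x y =>
          rw [hT, map_smul, LinearMap.rTensor_tmul]
          generalize comul (R := k) x = u
          induction u with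
          | zero => simp
          | add x y hx hy => simp only [map_add, smul_add, hx, hy, add_tmul]
          | tmul x z => simp [hT]
      rw [hS, h1, coassoc_apply]
      simp only [T, LinearMap.lTensor_comp, LinearMap.comp_apply]
    rw [key]
    exact hmem _

/-- Every element of a coalgebra over a field is a linear combination of entries of a matrix
on which the comultiplication is matrix multiplication. -/
theorem exists_matrix_comul {k A : Type*} [Field k] [AddCommGroup A] [Module k A]
    [Coalgebra k A] (a : A) :
    ∃ (n : ℕ) (c : Fin n → Fin n → A), a ∈ Submodule.span k {x | ∃ i j, c i j = x} ∧
      ∀ i j, comul (R := k) (c i j) = ∑ l, c i l ⊗ₜ[k] c l j := by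
  classical
  obtain ⟨V, hV, haV, hΔ⟩ := exists_finite_subcomodule (k := k) a
  let v := Module.finBasis k V
  have hv : ∀ j, ∃ c : Fin _ → A, comul (R := k) (v j : A) = ∑ i, (v i : A) ⊗ₜ[k] c i := fun j ↦ by
    obtain ⟨u, hu⟩ := hΔ (v j) (v j).2
    refine ⟨TensorProduct.equivFinsuppOfBasisLeft v u, ?_⟩
    rw [← hu]
    conv_lhs => rw [← (TensorProduct.equivFinsuppOfBasisLeft (N := A) v).symm_apply_apply u,
      TensorProduct.equivFinsuppOfBasisLeft_symm_apply]
    rw [Finsupp.sum_fintype _ _ (by simp)]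
    simp
  choose c hc using hv
  refine ⟨_, fun i j ↦ c j i, ?_, fun i j ↦ ?_⟩
  · have hvc : ∀ j, (v j : A) = ∑ i, counit (R := k) (v i : A) • c j i := fun j ↦ by
      have := congr(TensorProduct.lid k A (counit.rTensor A $(hc j)))
      rw [rTensor_counit_comul] at this
      simpa using this
    have : a = ∑ j, v.repr ⟨a, haV⟩ j • (v j : A) := by
      have := congr(V.subtype $(v.sum_repr ⟨a, haV⟩))
      simp only [map_sum, map_smul, Submodule.subtype_apply] at this
      exact this.symm
    rw [this]
    refine sum_mem fun j _ ↦ Submodule.smul_mem _ _ ?_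
    rw [hvc]
    exact sum_mem fun i _ ↦ Submodule.smul_mem _ _ (Submodule.subset_span ⟨i, j, rfl⟩)
  · obtain ⟨f, hf⟩ := (v.coord i).exists_extend
    have hf' : ∀ l, f (v l) = if l = i then 1 else 0 := fun l ↦ by
      have := congr($hf (v l))
      simpa [Finsupp.single_apply] using this
    let F : A ⊗[k] (A ⊗[k] A) →ₗ[k] A ⊗[k] A :=
      (TensorProduct.lid k (A ⊗[k] A)).toLinearMap ∘ₗ f.rTensor (A ⊗[k] A)
    have := congr(F $(coassoc_apply (R := k) (v j : A)))
    simp only [hc, map_sum, LinearMap.rTensor_tmul, LinearMap.lTensor_tmul, sum_tmul,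
      TensorProduct.assoc_tmul] at this
    simpa [F, hf'] using this.symm

end

section
open TensorProduct
open Coalgebra (comul counit rTensor_counit_comul lTensor_counit_comul)
open Bialgebra (counitAlgHom comulAlgHom)

/-- Finite subsets of a commutative bialgebra over a field lie in finitely generated
sub-bialgebras. -/
theorem exists_fg_subalgebra_comul_mem {k A : Type*} [Field k] [CommRing A] [Bialgebra k A]
    (s : Finset A) :
    ∃ B : Subalgebra k A, B.FG ∧ (∀ a ∈ s, a ∈ B) ∧
      ∀ b : B, comul (R := k) (b : A) ∈ (Algebra.TensorProduct.map B.val B.val).range := by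
  choose n c hc hΔ using exists_matrix_comul (k := k) (A := A)
  let S : Set A := ⋃ a ∈ s, Set.range fun ij : Fin (n a) × Fin (n a) ↦ c a ij.1 ij.2
  have hS : S.Finite := s.finite_toSet.biUnion fun a _ ↦ Set.finite_range _
  have hcS : ∀ a ∈ s, ∀ i j, c a i j ∈ Algebra.adjoin k S := fun a ha i j ↦
    Algebra.subset_adjoin (Set.mem_biUnion ha ⟨(i, j), rfl⟩)
  refine ⟨Algebra.adjoin k S, Subalgebra.fg_def.mpr ⟨S, hS, rfl⟩, fun a ha ↦ ?_, fun b ↦ ?_⟩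
  · have : Submodule.span k {x | ∃ i j, c a i j = x} ≤
        Subalgebra.toSubmodule (Algebra.adjoin k S) := by
      refine Submodule.span_le.mpr ?_
      rintro _ ⟨i, j, rfl⟩
      exact hcS a ha i j
    exact this (hc a)
  · have : Algebra.adjoin k S ≤ (Algebra.TensorProduct.map (Algebra.adjoin k S).val
        (Algebra.adjoin k S).val).range.comap (comulAlgHom k A) := by
      refine Algebra.adjoin_le fun x hx ↦ ?_
      obtain ⟨a, ha, ⟨i, j⟩, rfl⟩ := Set.mem_iUnion₂.mp hx
      change comul (R := k) (c a i j) ∈ (Algebra.TensorProduct.map (Algebra.adjoin k S).val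
        (Algebra.adjoin k S).val).range
      rw [hΔ]
      exact sum_mem fun l _ ↦ ⟨⟨c a i l, hcS a ha i l⟩ ⊗ₜ ⟨c a l j, hcS a ha l j⟩, by simp⟩
    exact this b.2

/-- On a sub-bialgebra, every point derivation at the counit is induced by a derivation. -/
theorem exists_derivation_counit_eq {k A : Type*} [Field k] [CommRing A] [Bialgebra k A]
    (B : Subalgebra k A)
    (hB : ∀ b : B, comul (R := k) (b : A) ∈ (Algebra.TensorProduct.map B.val B.val).range)
    (δ : B →ₗ[k] k) (hδ : ∀ a b, δ (a * b) = (counitAlgHom k A).comp B.val a * δ b +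
      (counitAlgHom k A).comp B.val b * δ a) :
    ∃ D : Derivation k B B, ∀ b, (counitAlgHom k A).comp B.val (D b) = δ b := by
  set ε := (counitAlgHom k A).comp B.val with hε
  let ι : B ⊗[k] B →ₐ[k] A ⊗[k] A := Algebra.TensorProduct.map B.val B.val
  have hι : Function.Injective ι := TensorProduct.map_injective_of_flat_flat B.val.toLinearMap
    B.val.toLinearMap Subtype.val_injective Subtype.val_injective
  let Δ : B →ₐ[k] B ⊗[k] B := (AlgEquiv.ofInjective ι hι).symm.toAlgHom.comp
    (((comulAlgHom k A).comp B.val).codRestrict ι.range hB)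
  have hΔ : ∀ b, ι (Δ b) = comul (R := k) (b : A) := fun b ↦
    congr($((AlgEquiv.ofInjective ι hι).apply_symm_apply ⟨_, hB b⟩).1)
  let R : (B →ₗ[k] k) → B ⊗[k] B →ₗ[k] B := fun φ ↦
    (TensorProduct.rid k B).toLinearMap ∘ₗ φ.lTensor B
  have hR : ∀ φ x y, R φ (x ⊗ₜ y) = φ y • x := fun φ x y ↦ by simp [R]
  have hRε : ∀ b, R ε.toLinearMap (Δ b) = b := fun b ↦ by
    have h1 : ∀ u, (R ε.toLinearMap u : A) = TensorProduct.rid k A (counit.lTensor A (ι u)) := by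
      intro u
      induction u with
      | zero => simp
      | add x y hx hy => simp only [map_add, Subalgebra.coe_add, hx, hy]
      | tmul x y => rw [hR]; simp [ι, hε]
    apply Subtype.ext
    rw [h1, hΔ, lTensor_counit_comul]
    simp
  have hεR : ∀ b, ε (R δ (Δ b)) = δ b := fun b ↦ by
    have h1 : ∀ u, ε (R δ u) = δ (TensorProduct.lid k B (ε.toLinearMap.rTensor B u)) := by
      intro u
      induction u with
      | zero => simp
      | add x y hx hy => simp only [map_add, hx, hy]
      | tmul x y => rw [hR]; simp [mul_comm]
    have h2 : ∀ u, (TensorProduct.lid k B (ε.toLinearMap.rTensor B u) : A) =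
        TensorProduct.lid k A (counit.rTensor A (ι u)) := by
      intro u
      induction u with
      | zero => simp
      | add x y hx hy => simp only [map_add, Subalgebra.coe_add, hx, hy]
      | tmul x y => simp [ι, hε]
    rw [h1]
    congr 1
    apply Subtype.ext
    rw [h2, hΔ, rTensor_counit_comul]
    simp
  have hmul : ∀ u w, R δ (u * w) =
      R ε.toLinearMap u * R δ w + R ε.toLinearMap w * R δ u := by
    intro u w
    induction u with
    | zero => simp
    | add x y hx hy => simp only [map_add, add_mul, mul_add, hx, hy]; ring
    | tmul x y =>
      induction w with
      | zero => simp
      | add x y hx hy => simp only [map_add, add_mul, mul_add, hx, hy]; ring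
      | tmul x' y' =>
        simp only [Algebra.TensorProduct.tmul_mul_tmul, hR, hδ, AlgHom.toLinearMap_apply,
          Algebra.smul_def, map_add, map_mul]
        ring
  exact ⟨Derivation.mk' (R δ ∘ₗ Δ.toLinearMap) fun a b ↦ by
    simp [hmul, hRε], hεR⟩

/-- A symmetric Hochschild 2-cocycle with values in the trivial module of an augmented algebra. -/
structure AugmentedCocycle {k B : Type*} [Field k] [CommRing B] [Algebra k B]
    (ε : B →ₐ[k] k) where
  /-- The underlying bilinear map. -/
  toFun : B →ₗ[k] B →ₗ[k] k
  symm : ∀ a b, toFun a b = toFun b a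
  cocycle : ∀ a b c, ε a * toFun b c + toFun a (b * c) = toFun (a * b) c + toFun a b * ε c

namespace AugmentedCocycle

variable {k B : Type*} [Field k] [CommRing B] [Algebra k B] {ε : B →ₐ[k] k}

theorem one_apply (f : AugmentedCocycle ε) (b : B) : f.toFun 1 b = ε b * f.toFun 1 1 := by
  have := f.cocycle 1 1 b
  simp only [map_one, one_mul] at this
  linear_combination this

/-- The square-zero extension of `B` by `k` defined by a cocycle. -/
def Ext (_ : AugmentedCocycle ε) : Type _ := B × k

variable (f : AugmentedCocycle ε)

instance : AddCommGroup f.Ext := inferInstanceAs (AddCommGroup (B × k))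

instance : Module k f.Ext := inferInstanceAs (Module k (B × k))

instance : Mul f.Ext :=
  ⟨fun x y ↦ (x.1 * y.1, ε x.1 * y.2 + ε y.1 * x.2 + f.toFun x.1 y.1)⟩

instance : One f.Ext := ⟨((1 : B), -f.toFun 1 1)⟩

variable {f}

theorem Ext.ext {x y : f.Ext} (h : x.1 = y.1) (h' : x.2 = y.2) : x = y := Prod.ext h h'

theorem Ext.fst_mul (x y : f.Ext) : (x * y).1 = x.1 * y.1 := rfl

theorem Ext.snd_mul (x y : f.Ext) :
    (x * y).2 = ε x.1 * y.2 + ε y.1 * x.2 + f.toFun x.1 y.1 := rfl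

theorem Ext.fst_add (x y : f.Ext) : (x + y).1 = x.1 + y.1 := rfl

theorem Ext.snd_add (x y : f.Ext) : (x + y).2 = x.2 + y.2 := rfl

theorem Ext.fst_smul (c : k) (x : f.Ext) : (c • x).1 = c • x.1 := rfl

theorem Ext.snd_smul (c : k) (x : f.Ext) : (c • x).2 = c * x.2 := rfl

theorem Ext.fst_one : (1 : f.Ext).1 = 1 := rfl

theorem Ext.snd_one : (1 : f.Ext).2 = -f.toFun 1 1 := rfl

theorem Ext.mul_comm' (x y : f.Ext) : x * y = y * x := by
  refine Ext.ext (mul_comm _ _) ?_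
  rw [snd_mul, snd_mul, f.symm]
  ring

theorem Ext.mul_add' (x y z : f.Ext) : x * (y + z) = x * y + x * z := by
  refine Ext.ext (mul_add _ _ _) ?_
  simp only [snd_mul, fst_add, snd_add, map_add]
  ring

theorem Ext.one_mul' (x : f.Ext) : 1 * x = x := by
  refine Ext.ext (one_mul _) ?_
  simp only [snd_mul, fst_one, snd_one, map_one, f.one_apply x.1]
  ring

theorem Ext.mul_assoc' (x y z : f.Ext) : x * y * z = x * (y * z) := by
  refine Ext.ext (mul_assoc _ _ _) ?_
  simp only [snd_mul, fst_mul, map_mul]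
  linear_combination -f.cocycle x.1 y.1 z.1

instance : CommRing f.Ext where
  __ := (inferInstance : AddCommGroup f.Ext)
  mul_comm := Ext.mul_comm'
  left_distrib := Ext.mul_add'
  right_distrib x y z := by rw [Ext.mul_comm', Ext.mul_add', Ext.mul_comm' z, Ext.mul_comm' z]
  one_mul := Ext.one_mul'
  mul_one x := by rw [Ext.mul_comm', Ext.one_mul']
  mul_assoc := Ext.mul_assoc'
  zero_mul x := by
    refine Ext.ext (zero_mul _) ?_
    rw [Ext.snd_mul]
    change ε (0 : B) * _ + _ * (0 : k) + f.toFun (0 : B) _ = 0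
    simp
  mul_zero x := by
    refine Ext.ext (mul_zero _) ?_
    rw [Ext.snd_mul]
    change _ * (0 : k) + ε (0 : B) * _ + f.toFun _ (0 : B) = 0
    simp

theorem Ext.smul_mul' (c : k) (x y : f.Ext) : c • x * y = c • (x * y) := by
  refine Ext.ext (smul_mul_assoc _ _ _) ?_
  simp only [snd_mul, snd_smul, fst_smul, map_smul, LinearMap.smul_apply, smul_eq_mul]
  ring

instance : Algebra k f.Ext :=
  Algebra.ofModule Ext.smul_mul' fun c x y ↦ by rw [mul_comm, Ext.smul_mul', mul_comm]

variable (f)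

/-- The projection of a square-zero extension onto the base. -/
def Ext.proj : f.Ext →ₐ[k] B :=
  AlgHom.ofLinearMap (LinearMap.fst k B k) rfl fun _ _ ↦ rfl

theorem Ext.proj_apply (x : f.Ext) : Ext.proj f x = x.1 := rfl

theorem Ext.proj_surjective : Function.Surjective (Ext.proj f) := fun b ↦ ⟨(b, (0 : k)), rfl⟩

instance [Algebra.FiniteType k B] : Algebra.FiniteType k f.Ext := by
  obtain ⟨s, hs⟩ := Algebra.FiniteType.out (R := k) (A := B)
  let i : B → f.Ext := fun b ↦ (b, (0 : k))
  let m : f.Ext := ((0 : B), (1 : k))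
  let S : Subalgebra k f.Ext := Algebra.adjoin k (insert m (i '' s))
  have hS : S.FG := Subalgebra.fg_def.mpr ⟨_, (s.finite_toSet.image i).insert m, rfl⟩
  have hπ : S.map (Ext.proj f) = ⊤ := by
    refine top_le_iff.mp (hs ▸ Algebra.adjoin_le fun b hb ↦ ?_)
    exact ⟨i b, Algebra.subset_adjoin (Set.mem_insert_of_mem _ ⟨b, hb, rfl⟩), rfl⟩
  suffices S = ⊤ from ⟨this ▸ hS⟩
  refine top_le_iff.mp fun x _ ↦ ?_
  obtain ⟨y, hy, hyx⟩ : x.1 ∈ S.map (Ext.proj f) := hπ ▸ Algebra.mem_top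
  have : x = y + (x.2 - y.2) • m := by
    refine Ext.ext ?_ ?_
    · rw [Ext.fst_add, Ext.fst_smul]
      change x.1 = y.1 + (_ • (0 : B))
      rw [smul_zero, add_zero]
      exact hyx.symm
    · rw [Ext.snd_add, Ext.snd_smul]
      change x.2 = y.2 + (x.2 - y.2) * 1
      ring
  rw [this]
  exact add_mem hy (S.smul_mem (Algebra.subset_adjoin (Set.mem_insert _ _)) _)

theorem Ext.mul_eq_zero {t y : f.Ext} (ht : Ext.proj f t = 0) (hy : ε (Ext.proj f y) = 0) :
    y * t = 0 := by
  rw [Ext.proj_apply] at ht hy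
  refine Ext.ext ?_ ?_
  · rw [fst_mul, ht, mul_zero]; rfl
  · rw [snd_mul, ht, hy, map_zero, map_zero, zero_mul, zero_mul, zero_add, zero_add]; rfl

/-- A cocycle on a finitely generated augmented algebra with enough derivations vanishes on
relations of degree two. -/
theorem sum_eq_zero [CharZero k] [Algebra.FiniteType k B]
    (hder : ∀ δ : B →ₗ[k] k, (∀ a b, δ (a * b) = ε a * δ b + ε b * δ a) →
      ∃ D : Derivation k B B, ∀ b, ε (D b) = δ b)
    {ι : Type*} (s : Finset ι) (u v : ι → B) (hu : ∀ i ∈ s, ε (u i) = 0)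
    (hv : ∀ i ∈ s, ε (v i) = 0)
    (h : ∑ i ∈ s, u i * v i = 0) : ∑ i ∈ s, f.toFun (u i) (v i) = 0 := by
  have : IsNoetherianRing f.Ext := Algebra.FiniteType.isNoetherianRing k _
  let j : B → f.Ext := fun b ↦ (b, (0 : k))
  let snd : f.Ext →ₗ[k] k := LinearMap.snd k B k
  have key := eq_zero_of_mem_ker_of_mem_sq (Ext.proj f) (Ext.proj_surjective f) ε
    (fun t ht y hy ↦ Ext.mul_eq_zero f ht hy) hder (z := ∑ i ∈ s, j (u i) * j (v i))
    (by rw [map_sum, ← h]; rfl)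
    (sum_mem fun i hi ↦ by
      rw [pow_two]; exact Ideal.mul_mem_mul (hu i hi) (hv i hi))
  have := congr(snd $key)
  rw [map_sum, map_zero] at this
  rw [← this]
  refine Finset.sum_congr rfl fun i hi ↦ ?_
  change _ = ε (u i) * (0 : k) + ε (v i) * (0 : k) + f.toFun (u i) (v i)
  simp

end AugmentedCocycle

end

section
open TensorProduct
open Coalgebra (comul counit)
open Bialgebra (counitAlgHom comulAlgHom)

/-- Over a field, a linear map vanishing on the kernel of another one factors through it. -/
theorem LinearMap.exists_comp_eq_of_ker_le_ker {k V W M : Type*} [Field k] [AddCommGroup V]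
    [Module k V] [AddCommGroup W] [Module k W] [AddCommGroup M] [Module k M]
    (p : V →ₗ[k] W) (q : V →ₗ[k] M) (h : LinearMap.ker p ≤ LinearMap.ker q) :
    ∃ g : W →ₗ[k] M, g ∘ₗ p = q := by
  obtain ⟨g, hg⟩ := LinearMap.exists_extend
    ((LinearMap.ker p).liftQ q h ∘ₗ p.quotKerEquivRange.symm.toLinearMap)
  refine ⟨g, LinearMap.ext fun x ↦ ?_⟩
  have := congr($hg (p.quotKerEquivRange ((LinearMap.ker p).mkQ x)))
  simpa using this

/-- Symmetric Hochschild 2-cocycles of a commutative bialgebra in characteristic zero with values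
in a trivial module are coboundaries. -/
theorem exists_eq_coboundary_of_counit {k A M : Type*} [Field k] [CharZero k] [CommRing A]
    [Bialgebra k A] [AddCommGroup M] [Module k M] (f : A →ₗ[k] A →ₗ[k] M)
    (symm : ∀ a b, f a b = f b a)
    (cocycle : ∀ a b c, counit (R := k) a • f b c + f a (b * c) =
      f (a * b) c + counit (R := k) c • f a b) :
    ∃ h : A →ₗ[k] M, ∀ a b, f a b =
      counit (R := k) a • h b - h (a * b) + counit (R := k) b • h a := by
  have one_apply (b : A) : f 1 b = counit (R := k) b • f 1 1 := by
    have := cocycle 1 1 b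
    simp only [Bialgebra.counit_one, one_smul, one_mul] at this
    exact add_left_cancel this
  let p : A →ₗ[k] A := LinearMap.id - Algebra.linearMap k A ∘ₗ counit
  have hp (a : A) : p a = a - algebraMap k A (counit a) := rfl
  have hεp (a : A) : counit (R := k) (p a) = 0 := by simp [hp]
  let Ψ : A ⊗[k] A →ₗ[k] A := LinearMap.mul' k A ∘ₗ TensorProduct.map p p
  let Φ : A ⊗[k] A →ₗ[k] M := TensorProduct.lift f ∘ₗ TensorProduct.map p p
  have hker : LinearMap.ker Ψ ≤ LinearMap.ker Φ := by
    classical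
    intro t ht
    rw [LinearMap.mem_ker] at ht ⊢
    obtain ⟨S, rfl⟩ := TensorProduct.exists_finset t
    rw [← Module.forall_dual_apply_eq_zero_iff k]
    intro φ
    obtain ⟨B, hfg, hS, hB⟩ := exists_fg_subalgebra_comul_mem (k := k)
      (S.image Prod.fst ∪ S.image Prod.snd)
    have : Algebra.FiniteType k B := (Subalgebra.fg_iff_finiteType B).mp hfg
    have hpB (a : A) (ha : a ∈ B) : p a ∈ B := sub_mem ha (B.algebraMap_mem _)
    have h1 (i) (hi : i ∈ S) : i.1 ∈ B :=
      hS _ (Finset.mem_union_left _ (Finset.mem_image_of_mem _ hi))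
    have h2 (i) (hi : i ∈ S) : i.2 ∈ B :=
      hS _ (Finset.mem_union_right _ (Finset.mem_image_of_mem _ hi))
    let F : AugmentedCocycle ((counitAlgHom k A).comp B.val) :=
      { toFun := (f.compr₂ φ).compl₁₂ B.val.toLinearMap B.val.toLinearMap
        symm a b := congr(φ $(symm a b))
        cocycle a b c := by
          have := congr(φ $(cocycle a b c))
          simp only [map_add, map_smul, smul_eq_mul] at this
          simpa [mul_comm] using this }
    have key := F.sum_eq_zero (exists_derivation_counit_eq B hB) S.attach
      (fun i ↦ ⟨p i.1.1, hpB _ (h1 _ i.2)⟩) (fun i ↦ ⟨p i.1.2, hpB _ (h2 _ i.2)⟩)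
      (fun i _ ↦ hεp _) (fun i _ ↦ hεp _) (by
        apply Subtype.ext
        rw [map_sum, ← S.sum_attach] at ht
        simpa [Ψ] using ht)
    rw [map_sum, map_sum, ← S.sum_attach]
    exact key
  obtain ⟨g, hg⟩ := LinearMap.exists_comp_eq_of_ker_le_ker Ψ Φ hker
  have hg' (a b : A) : g (p a * p b) = f (p a) (p b) := by
    simpa [Ψ, Φ] using congr($hg (a ⊗ₜ b))
  refine ⟨counit.smulRight (f 1 1) - g ∘ₗ p, fun a b ↦ ?_⟩
  have hmul : p (a * b) = p a * p b + counit (R := k) a • p b + counit (R := k) b • p a := by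
    simp only [hp, Bialgebra.counit_mul, map_mul, Algebra.smul_def]
    ring
  have hf : f (p a) (p b) = f a b - (counit (R := k) a * counit (R := k) b) • f 1 1 := by
    simp only [hp, map_sub, LinearMap.sub_apply, Algebra.algebraMap_eq_smul_one, map_smul,
      LinearMap.smul_apply, symm a 1, one_apply a, one_apply b]
    module
  simp only [LinearMap.sub_apply, LinearMap.smulRight_apply, LinearMap.comp_apply, hmul, map_add,
    map_smul, hg', hf, Bialgebra.counit_mul]
  module

end

section
open TensorProduct
open Coalgebra (comul counit)
open HopfAlgebra (antipode antipodeAlgHom)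

/-- The bilinear map `(a ⊗ a', b ⊗ b') ↦ θ (a' * b') • f a b`. -/
noncomputable def twistBilin {k A M : Type*} [CommRing k] [CommRing A] [Algebra k A]
    [AddCommGroup M] [Module k M] [Module A M] [IsScalarTower k A M] (θ : A →ₐ[k] A)
    (f : A →ₗ[k] A →ₗ[k] M) : A ⊗[k] A →ₗ[k] A ⊗[k] A →ₗ[k] M :=
  TensorProduct.curry (TensorProduct.lift (Algebra.lsmul k k M).toLinearMap.flip ∘ₗ
    TensorProduct.map (TensorProduct.lift f) (θ.toLinearMap ∘ₗ LinearMap.mul' k A) ∘ₗ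
    (TensorProduct.tensorTensorTensorComm k A A A A).toLinearMap)

section
variable {k A M : Type*} [CommRing k] [CommRing A] [Algebra k A]
    [AddCommGroup M] [Module k M] [Module A M] [IsScalarTower k A M]

@[simp]
theorem twistBilin_tmul_tmul (θ : A →ₐ[k] A) (f : A →ₗ[k] A →ₗ[k] M) (a a' b b' : A) :
    twistBilin θ f (a ⊗ₜ a') (b ⊗ₜ b') = θ (a' * b') • f a b := by
  simp [twistBilin, mul_smul]

theorem twistBilin_symm (θ : A →ₐ[k] A) (f : A →ₗ[k] A →ₗ[k] M) (symm : ∀ a b, f a b = f b a)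
    (u v : A ⊗[k] A) : twistBilin θ f u v = twistBilin θ f v u := by
  induction u with
  | zero => simp
  | add x y hx hy => simp only [map_add, LinearMap.add_apply, hx, hy]
  | tmul a a' =>
    induction v with
    | zero => simp
    | add x y hx hy => simp only [map_add, LinearMap.add_apply, hx, hy]
    | tmul b b' => simp only [twistBilin_tmul_tmul, symm a b, mul_comm]

theorem twistBilin_cocycle (θ : A →ₐ[k] A) (f : A →ₗ[k] A →ₗ[k] M)
    (cocycle : ∀ a b c, a • f b c + f a (b * c) = f (a * b) c + c • f a b) (u v w : A ⊗[k] A) :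
    LinearMap.mul' k A (θ.toLinearMap.lTensor A u) • twistBilin θ f v w +
      twistBilin θ f u (v * w) =
    twistBilin θ f (u * v) w +
      LinearMap.mul' k A (θ.toLinearMap.lTensor A w) • twistBilin θ f u v := by
  induction u with
  | zero => simp
  | add x y hx hy =>
    simp only [map_add, LinearMap.add_apply, add_smul, add_mul, smul_add]
    linear_combination (norm := module) hx + hy
  | tmul a a' =>
    induction v with
    | zero => simp
    | add x y hx hy =>
      simp only [map_add, LinearMap.add_apply, add_mul, mul_add, smul_add]
      linear_combination (norm := module) hx + hy
    | tmul b b' =>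
      induction w with
      | zero => simp
      | add x y hx hy =>
        simp only [map_add, add_smul, mul_add, smul_add]
        linear_combination (norm := module) hx + hy
      | tmul c c' =>
        have := congr(θ (a' * b' * c') • $(cocycle a b c))
        simp only [smul_add, smul_smul] at this
        simp only [LinearMap.lTensor_tmul, AlgHom.toLinearMap_apply, LinearMap.mul'_apply,
          twistBilin_tmul_tmul, Algebra.TensorProduct.tmul_mul_tmul, smul_smul]
        convert this using 3 <;> simp only [map_mul] <;> ring

end

/-- Twisting by the antipode is inverted by twisting by the identity. -/
theorem twistBilin_id_twistBilin_antipode {k A M : Type*} [CommRing k] [CommRing A]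
    [HopfAlgebra k A] [AddCommGroup M] [Module k M] [Module A M] [IsScalarTower k A M]
    (f : A →ₗ[k] A →ₗ[k] M) (a b : A) :
    twistBilin (AlgHom.id k A)
      ((twistBilin (antipodeAlgHom k A) f).compl₁₂ comul comul) (comul a) (comul b) = f a b := by
  set F := (twistBilin (antipodeAlgHom k A) f) with hF
  let G : (A ⊗[k] A) ⊗[k] A →ₗ[k] (A ⊗[k] A) ⊗[k] A →ₗ[k] M :=
    TensorProduct.curry (TensorProduct.lift (Algebra.lsmul k k M).toLinearMap.flip ∘ₗ
      TensorProduct.map (TensorProduct.lift F) (LinearMap.mul' k A) ∘ₗ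
      (TensorProduct.tensorTensorTensorComm k (A ⊗[k] A) A (A ⊗[k] A) A).toLinearMap)
  have hG (u v : A ⊗[k] A) (a b : A) : G (u ⊗ₜ a) (v ⊗ₜ b) = (a * b) • F u v := by
    simp [G, mul_smul]
  have h1 (u v : A ⊗[k] A) : twistBilin (AlgHom.id k A) (F.compl₁₂ comul comul) u v =
      G (comul.rTensor A u) (comul.rTensor A v) := by
    induction u with
    | zero => simp
    | add x y hx hy => simp only [map_add, LinearMap.add_apply, hx, hy]
    | tmul a a' =>
      induction v with
      | zero => simp
      | add x y hx hy => simp only [map_add, hx, hy]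
      | tmul b b' => simp [hG]
  let ν : A ⊗[k] A →ₗ[k] A := LinearMap.mul' k A ∘ₗ (antipode k).rTensor A
  have h2 (u v : A ⊗[k] (A ⊗[k] A)) : G ((TensorProduct.assoc k A A A).symm u)
      ((TensorProduct.assoc k A A A).symm v) =
      twistBilin (AlgHom.id k A) f (ν.lTensor A u) (ν.lTensor A v) := by
    induction u with
    | zero => simp
    | add x y hx hy => simp only [map_add, LinearMap.add_apply, hx, hy]
    | tmul a x =>
      induction x with
      | zero => simp
      | add x y hx hy => simp only [map_add, tmul_add, LinearMap.add_apply, hx, hy]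
      | tmul a' a'' =>
        induction v with
        | zero => simp
        | add x y hx hy => simp only [map_add, hx, hy]
        | tmul b y =>
          induction y with
          | zero => simp
          | add x y hx hy => simp only [map_add, tmul_add, hx, hy]
          | tmul b' b'' =>
            simp only [assoc_symm_tmul, hG, hF, twistBilin_tmul_tmul, LinearMap.lTensor_tmul, ν,
              LinearMap.comp_apply, LinearMap.rTensor_tmul, LinearMap.mul'_apply, smul_smul,
              map_mul, AlgHom.id_apply, HopfAlgebra.antipodeAlgHom_apply]
            congr 1
            ring
  have h3 (a : A) : ν.lTensor A (comul.lTensor A (comul a)) = a ⊗ₜ 1 := by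
    have : ν ∘ₗ comul = Algebra.linearMap k A ∘ₗ counit :=
      HopfAlgebra.mul_antipode_rTensor_comul
    rw [← LinearMap.comp_apply, ← LinearMap.lTensor_comp, this, LinearMap.lTensor_comp,
      LinearMap.comp_apply, Coalgebra.lTensor_counit_comul]
    simp
  rw [h1, ← Coalgebra.coassoc_symm_apply, ← Coalgebra.coassoc_symm_apply, h2, h3, h3]
  simp

/-- Symmetric Hochschild 2-cocycles of a commutative Hopf algebra over a field of characteristic
zero are coboundaries. -/
theorem exists_eq_coboundary {k A M : Type*} [Field k] [CharZero k] [CommRing A]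
    [HopfAlgebra k A] [AddCommGroup M] [Module k M] [Module A M] [IsScalarTower k A M]
    (f : A →ₗ[k] A →ₗ[k] M) (symm : ∀ a b, f a b = f b a)
    (cocycle : ∀ a b c, a • f b c + f a (b * c) = f (a * b) c + c • f a b) :
    ∃ h : A →ₗ[k] M, ∀ a b, f a b = a • h b - h (a * b) + b • h a := by
  let f' := (twistBilin (antipodeAlgHom k A) f).compl₁₂ comul comul
  have hμ (a : A) : LinearMap.mul' k A ((antipodeAlgHom k A).toLinearMap.lTensor A (comul a)) =
      algebraMap k A (counit a) := HopfAlgebra.mul_antipode_lTensor_comul_apply a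
  obtain ⟨h', hh'⟩ := exists_eq_coboundary_of_counit f'
    (fun a b ↦ twistBilin_symm _ f symm _ _) fun a b c ↦ by
      have := twistBilin_cocycle (antipodeAlgHom k A) f cocycle (comul a) (comul b) (comul c)
      simpa only [f', LinearMap.compl₁₂_apply, hμ, algebraMap_smul, ← Bialgebra.comul_mul]
        using this
  let H : A ⊗[k] A →ₗ[k] M :=
    TensorProduct.lift ((Algebra.lsmul k k M).toLinearMap.flip ∘ₗ h')
  have hH (a a' : A) : H (a ⊗ₜ a') = a' • h' a := by simp [H]
  let E : A ⊗[k] A →ₗ[k] A := TensorProduct.lid k A ∘ₗ counit.rTensor A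
  have hE (a a' : A) : E (a ⊗ₜ a') = counit (R := k) a • a' := by simp [E]
  have hEΔ (a : A) : E (comul a) = a := by simp [E]
  have key (u v : A ⊗[k] A) : twistBilin (AlgHom.id k A) f' u v =
      E u • H v - H (u * v) + E v • H u := by
    induction u with
    | zero => simp
    | add x y hx hy =>
      simp only [map_add, LinearMap.add_apply, hx, hy, add_smul, add_mul, smul_add]
      abel
    | tmul a a' =>
      induction v with
      | zero => simp
      | add x y hx hy =>
        simp only [map_add, hx, hy, add_smul, mul_add, smul_add]
        abel
      | tmul b b' =>
        simp only [twistBilin_tmul_tmul, AlgHom.id_apply, hh', hH, hE, smul_add, smul_sub,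
          Algebra.TensorProduct.tmul_mul_tmul, smul_smul, smul_comm _ (counit _)]
        rw [smul_mul_assoc, smul_mul_assoc, smul_assoc, smul_assoc, mul_comm b']
  refine ⟨H ∘ₗ comul, fun a b ↦ ?_⟩
  rw [← twistBilin_id_twistBilin_antipode f a b, key, hEΔ, hEΔ, ← Bialgebra.comul_mul]
  rfl

end

/-- A square-zero extension of a commutative Hopf algebra in characteristic zero splits. -/
theorem exists_algHom_section {k A E : Type*} [Field k] [CharZero k] [CommRing A]
    [HopfAlgebra k A] [CommRing E] [Algebra k E] (π : E →ₐ[k] A) (hπ : Function.Surjective π)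
    (hsq : ∀ x y, π x = 0 → π y = 0 → x * y = 0) :
    ∃ g : A →ₐ[k] E, π.comp g = AlgHom.id k A := by
  obtain ⟨s, hs⟩ := π.toLinearMap.exists_rightInverse_of_surjective (LinearMap.range_eq_top.2 hπ)
  replace hs (a : A) : π (s a) = a := congr($hs a)
  let M : Submodule k E := LinearMap.ker π.toLinearMap
  have hM (m : M) : π m = 0 := m.2
  have hs_mul (x y : E) (m : M) (h : π x = π y) : x * m = y * m := by
    rw [← sub_eq_zero, ← sub_mul]
    exact hsq _ _ (by simp [h]) (hM m)
  let _ : Module A M :=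
    { smul a m := ⟨s a * m, by simp [M, hM]⟩
      one_smul m := Subtype.ext <| by
        change s 1 * m = m
        rw [hs_mul _ 1 m (by simp [hs]), one_mul]
      mul_smul a b m := Subtype.ext <| by
        change s (a * b) * m = s a * (s b * m)
        rw [hs_mul _ (s a * s b) m (by simp [hs]), mul_assoc]
      smul_zero a := Subtype.ext (mul_zero _)
      smul_add a x y := Subtype.ext (mul_add _ _ _)
      add_smul a b m := Subtype.ext <| by
        change s (a + b) * m = s a * m + s b * m
        rw [map_add, add_mul]
      zero_smul m := Subtype.ext <| by
        change s 0 * m = 0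
        rw [map_zero, zero_mul] }
  have smul_def (a : A) (m : M) : ((a • m : M) : E) = s a * m := rfl
  have : IsScalarTower k A M := ⟨fun c a m ↦ Subtype.ext <| by
    simp only [smul_def, Submodule.coe_smul, map_smul, smul_mul_assoc]⟩
  let f : A →ₗ[k] A →ₗ[k] M := LinearMap.mk₂ k
    (fun a b ↦ ⟨s a * s b - s (a * b), by simp [M, hs]⟩)
    (fun a a' b ↦ Subtype.ext <| by simp [add_mul]; ring)
    (fun c a b ↦ Subtype.ext <| by simp [smul_sub])
    (fun a b b' ↦ Subtype.ext <| by simp [mul_add]; ring)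
    (fun c a b ↦ Subtype.ext <| by simp [smul_sub])
  have hf (a b : A) : (f a b : E) = s a * s b - s (a * b) := rfl
  obtain ⟨h, hh⟩ := exists_eq_coboundary f
    (fun a b ↦ Subtype.ext <| by rw [hf, hf, mul_comm, mul_comm a])
    (fun a b c ↦ Subtype.ext <| by
      simp only [Submodule.coe_add, smul_def, hf, mul_assoc]
      ring)
  let g : A →ₗ[k] E := s - M.subtype ∘ₗ h
  have hg (a : A) : g a = s a - h a := rfl
  have hπg (a : A) : π (g a) = a := by simp [hg, hs, hM]
  have hmul (a b : A) : g (a * b) = g a * g b := by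
    have h1 := congr(($(hh a b) : E))
    simp only [Submodule.coe_add, Submodule.coe_sub, smul_def, hf] at h1
    simp only [hg]
    linear_combination -h1 - hsq _ _ (hM (h a)) (hM (h b))
  have hone : g 1 = 1 := by
    have h1 : (g 1 - 1) * (g 1 - 1) = 0 := hsq _ _ (by simp [hπg]) (by simp [hπg])
    have h2 := hmul 1 1
    rw [one_mul] at h2
    linear_combination (-1) * h1 - h2
  exact ⟨AlgHom.ofLinearMap g hone hmul, AlgHom.ext hπg⟩

/-!
STATEMENT 15: Every affine group scheme over a field of characteristic zero is formally
smooth: if k is a field of characteristic zero and A is a commutative Hopf algebra over k,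
then A is formally smooth over k (every k-algebra map A → R/I, with I ⊆ R a square-zero
ideal, lifts to A → R).
-/

theorem statement15 (k : Type) [Field k] [CharZero k]
    (A : Type) [CommRing A] [HopfAlgebra k A] :
    Algebra.FormallySmooth k A := by
  let f : MvPolynomial A k →ₐ[k] A := MvPolynomial.aeval id
  have hf : Function.Surjective f := fun a ↦ ⟨.X a, by simp [f]⟩
  have hsurj : Function.Surjective f.kerSquareLift :=
    Ideal.Quotient.lift_surjective_of_surjective _ _ hf
  have hsq : RingHom.ker f.kerSquareLift.toRingHom ^ 2 = ⊥ := by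
    rw [AlgHom.ker_kerSquareLift, Ideal.cotangentIdeal_square]
  obtain ⟨g, hg⟩ := exists_algHom_section f.kerSquareLift hsurj fun x y hx hy ↦ by
    have hxy := Ideal.mul_mem_mul (I := RingHom.ker f.kerSquareLift.toRingHom)
      (J := RingHom.ker f.kerSquareLift.toRingHom) hx hy
    rwa [← pow_two, hsq, Ideal.mem_bot] at hxy
  exact Algebra.FormallySmooth.of_split f g hg
end
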